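/- arXiv:1412.5466 — 4 statements merged into one kernel-verified Lean document; each statement's English description precedes it below -/
import Mathlib

section
/- Let q be a prime power, F_q the finite field with q elements, n ≥ 1, and let t be even with 2 ≤ t ≤ 2n. Let α = (α_1,…,α_t) ∈ F_q^t be nonzero with α_t = 0, and let β = (β_1,…,β_t) ∈ F_q^t with β_t ≠ 0. For x = (x_{t+1},…,x_{2n+1}) and y = (y_{t+1},…,y_{2n+1}) in F_q^{2n+1−t}, write = (α_1,…,α_t,x_{t+1},…,x_{2n+1}) ∈ F_q^{2n+1} and B̂ = (β_1,…,β_t,y_{t+1},…,y_{2n+1}) ∈ F_q^{2n+1}. Set c = α_1² + Σ_{i=1}^{t/2−1} α_{2i} α_{2i+1}. Then the number of pairs (x, y) ∈ F_q^{2n+1−t} × F_q^{2n+1−t} satisfying Q(Â) = 0, Q(B̂) = 0 and b(Â, B̂) = 0 equals η · q^{2n−t}, where η = q^{2n−t−1} + q^{n−t/2} − q^{n−t/2−1} if c = 0, and η = q^{2n−t−1} − q^{n−t/2−1} if c ≠ 0. -/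
/-- Splitting a vector of odd length into its first entry and two interleaved halves. -/
def interleaveEquiv (F : Type*) {N m : ℕ} (h : N = 2 * m + 1) :
    (Fin N → F) ≃ F × ((Fin m → F) × (Fin m → F)) where
  toFun x := (x ⟨0, by omega⟩, fun i => x ⟨2 * (i : ℕ) + 1, by omega⟩,
    fun i => x ⟨2 * (i : ℕ) + 2, by omega⟩)
  invFun p j :=
    if h0 : (j : ℕ) = 0 then p.1
    else if h1 : (j : ℕ) % 2 = 1 then p.2.1 ⟨((j : ℕ) - 1) / 2, by omega⟩
    else p.2.2 ⟨((j : ℕ) - 2) / 2, by omega⟩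
  left_inv x := by
    funext j
    dsimp only
    split_ifs <;> congr 1 <;> apply Fin.ext <;> dsimp only <;> omega
  right_inv p := by
    obtain ⟨a, u, v⟩ := p
    refine Prod.ext (by simp) (Prod.ext ?_ ?_)
    · funext i
      have h1 : (2 * (i : ℕ) + 1) % 2 = 1 := by omega
      simp [h1]
    · funext i
      have h1 : ¬ (2 * (i : ℕ) + 2) % 2 = 1 := by omega
      simp

/-- If two conditions each determine one of the leading scalars, only the remaining condition
and the free coordinates contribute to the number of solutions. -/
lemma card_pairs_of_linear_conditions {F X : Type*} [Field F] (P : X → Prop)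
    (f : X → F) (g : X → X → F) {b : F} (hb : b ≠ 0) :
    Nat.card {p : (F × X) × (F × X) //
        P p.1.2 ∧ f p.2.2 + b * p.2.1 = 0 ∧ g p.1.2 p.2.2 + b * p.1.1 = 0}
      = Nat.card {x // P x} * Nat.card X := by
  rw [← Nat.card_prod]
  have key : ∀ r s : F, r + b * s = 0 ↔ s = -r / b := fun r s => by
    rw [eq_div_iff hb]
    constructor <;> intro h <;> linear_combination h
  refine Nat.card_congr
    { toFun := fun p => (⟨p.1.1.2, p.2.1⟩, p.1.2.2)
      invFun := fun z => ⟨((-g z.1.1 z.2 / b, z.1.1), (-f z.2 / b, z.2)),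
        z.1.2, (key _ _).2 rfl, (key _ _).2 rfl⟩
      left_inv := ?_
      right_inv := fun _ => rfl }
  rintro ⟨⟨⟨a, x⟩, ⟨a', y⟩⟩, hP, hf, hg⟩
  dsimp only at hf hg
  obtain rfl := (key _ _).1 hf
  obtain rfl := (key _ _).1 hg
  rfl

/-- The number of solutions of `a * b = s` over a finite field. -/
lemma card_mul_eq {F : Type*} [Field F] [Fintype F] [DecidableEq F] (s : F) :
    ∑ a : F, ∑ b : F, (if a * b = s then (1 : ℤ) else 0)
      = (Fintype.card F - 1) + if s = 0 then (Fintype.card F : ℤ) else 0 := by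
  rw [← Finset.add_sum_erase _ _ (Finset.mem_univ (0 : F))]
  have h : ∀ a ∈ Finset.univ.erase (0 : F),
      ∑ b : F, (if a * b = s then (1 : ℤ) else 0) = 1 := by
    intro a ha
    have ha : a ≠ 0 := by simpa using ha
    have : ∀ b, a * b = s ↔ b = s / a := fun b => by rw [eq_div_iff ha, mul_comm]
    simp [this]
  rw [Finset.sum_congr rfl h]
  have : 1 ≤ Fintype.card F := Fintype.card_pos
  rw [Finset.sum_const, Finset.card_erase_of_mem (Finset.mem_univ _), Finset.card_univ]
  by_cases hs : s = 0
  · simp [hs, Nat.cast_sub this]; ring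
  · simp [hs, Ne.symm hs, Nat.cast_sub this]

/-- The number of zeros of `s + ∑ i, u i * v i`, for a hyperbolic form in `2 * m` variables. -/
lemma card_hyperbolic {F : Type*} [Field F] [Fintype F] [DecidableEq F] (m : ℕ) (s : F) :
    (Fintype.card F : ℤ) *
        ∑ u : Fin m → F, ∑ v : Fin m → F, (if s + ∑ i, u i * v i = 0 then (1 : ℤ) else 0)
      = (Fintype.card F : ℤ) ^ (2 * m) - (Fintype.card F : ℤ) ^ m
        + if s = 0 then (Fintype.card F : ℤ) ^ (m + 1) else 0 := by
  induction m generalizing s with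
  | zero => simp
  | succ m ih =>
    have e : ∀ f : (Fin (m + 1) → F) → ℤ,
        ∑ u, f u = ∑ a : F, ∑ u : Fin m → F, f (Fin.cons a u) := fun f => by
      rw [← (Fin.consEquiv (fun _ : Fin (m + 1) => F)).sum_comp, Fintype.sum_prod_type]
      rfl
    simp only [e, Fin.sum_univ_succ, Fin.cons_zero, Fin.cons_succ, ← add_assoc]
    have swap : ∀ a : F, (∑ u : Fin m → F, ∑ b : F, ∑ v : Fin m → F,
        (if s + a * b + ∑ i, u i * v i = 0 then (1 : ℤ) else 0)) =
        ∑ b : F, ∑ u : Fin m → F, ∑ v : Fin m → F,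
        (if s + a * b + ∑ i, u i * v i = 0 then (1 : ℤ) else 0) := fun a => Finset.sum_comm
    have h1 : ∀ a b : F, (if s + a * b = 0 then (Fintype.card F : ℤ) ^ (m + 1) else 0)
        = (Fintype.card F : ℤ) ^ (m + 1) * if a * b = -s then 1 else 0 := fun a b => by
      have : s + a * b = 0 ↔ a * b = -s := by rw [add_comm, add_eq_zero_iff_eq_neg]
      simp [this]
    rw [Finset.mul_sum, Finset.sum_congr rfl fun a _ => by rw [swap a, Finset.mul_sum]]
    simp only [ih, h1, Finset.sum_add_distrib, Finset.sum_const, Finset.card_univ,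
      ← Finset.mul_sum, card_mul_eq, neg_eq_zero, nsmul_eq_mul]
    split_ifs <;> ring

lemma natCard_hyperbolic {F : Type*} [Field F] [Fintype F] [DecidableEq F] (m : ℕ) (s : F) :
    Nat.card {p : (Fin m → F) × (Fin m → F) // s + ∑ i, p.1 i * p.2 i = 0}
      = if s = 0 then Fintype.card F ^ (2 * m - 1) + Fintype.card F ^ m - Fintype.card F ^ (m - 1)
        else Fintype.card F ^ (2 * m - 1) - Fintype.card F ^ (m - 1) := by
  rcases m with _ | m
  · by_cases hs : s = 0 <;> simp [hs]
  have key := card_hyperbolic (m + 1) s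
  rw [← Fintype.sum_prod_type'
    (f := fun u v : Fin (m + 1) → F => if s + ∑ i, u i * v i = 0 then (1 : ℤ) else 0),
    Finset.sum_boole] at key
  have hq : 0 < Fintype.card F := Fintype.card_pos
  have hle : Fintype.card F ^ m ≤ Fintype.card F ^ (2 * m + 1) :=
    Nat.pow_le_pow_right hq (by omega)
  have hq' : (Fintype.card F : ℤ) ≠ 0 := by exact_mod_cast hq.ne'
  have i1 : 2 * (m + 1) - 1 = 2 * m + 1 := by omega
  rw [i1, Nat.add_sub_cancel, Nat.card_eq_fintype_card, Fintype.card_subtype]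
  rw [← Nat.cast_inj (R := ℤ), ← mul_right_inj' hq', key]
  split_ifs
  · rw [Nat.cast_sub (by omega)]; push_cast; ring
  · rw [Nat.cast_sub hle]; push_cast; ring


/-- The parabolic quadratic form `Q(x) = x_1^2 + Σ_{i=1}^n x_{2i} x_{2i+1}`
on `F^{2n+1}` (coordinates 0-indexed). -/
def Qform {F : Type*} [Field F] (n : ℕ) (x : Fin (2*n+1) → F) : F :=
  x ⟨0, by omega⟩ ^ 2 +
    ∑ i : Fin n, x ⟨2*(i:ℕ)+1, by have := i.isLt; omega⟩ *
                 x ⟨2*(i:ℕ)+2, by have := i.isLt; omega⟩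

/-- The polar form `b(x,y) = 2 x_1 y_1 + Σ_{i=1}^n (x_{2i} y_{2i+1} + x_{2i+1} y_{2i})`
of `Qform` on `F^{2n+1}` (coordinates 0-indexed). -/
def bform {F : Type*} [Field F] (n : ℕ) (x y : Fin (2*n+1) → F) : F :=
  2 * x ⟨0, by omega⟩ * y ⟨0, by omega⟩ +
    ∑ i : Fin n,
      (x ⟨2*(i:ℕ)+1, by have := i.isLt; omega⟩ * y ⟨2*(i:ℕ)+2, by have := i.isLt; omega⟩ +
       x ⟨2*(i:ℕ)+2, by have := i.isLt; omega⟩ * y ⟨2*(i:ℕ)+1, by have := i.isLt; omega⟩)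

theorem stmt8 (q n t : ℕ) (hn : 1 ≤ n) (ht2 : 2 ≤ t) (htn : t ≤ 2*n) (hteven : Even t)
    (F : Type*) [Field F] [Fintype F] [DecidableEq F] (hq : Fintype.card F = q)
    (α β : Fin t → F) (hα : α ≠ 0)
    (hαt : α ⟨t-1, by omega⟩ = 0) (hβt : β ⟨t-1, by omega⟩ ≠ 0) :
    let Ahat : (Fin (2*n+1-t) → F) → (Fin (2*n+1) → F) := fun x j =>
      if h : (j:ℕ) < t then α ⟨j, h⟩ else x ⟨(j:ℕ) - t, by have := j.isLt; omega⟩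
    let Bhat : (Fin (2*n+1-t) → F) → (Fin (2*n+1) → F) := fun y j =>
      if h : (j:ℕ) < t then β ⟨j, h⟩ else y ⟨(j:ℕ) - t, by have := j.isLt; omega⟩
    let c : F := α ⟨0, by omega⟩ ^ 2 +
      ∑ i : Fin (t/2 - 1), α ⟨2*(i:ℕ)+1, by have := i.isLt; omega⟩ *
                           α ⟨2*(i:ℕ)+2, by have := i.isLt; omega⟩
    Nat.card {p : (Fin (2*n+1-t) → F) × (Fin (2*n+1-t) → F) //
        Qform n (Ahat p.1) = 0 ∧ Qform n (Bhat p.2) = 0 ∧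
        bform n (Ahat p.1) (Bhat p.2) = 0}
      = (if c = 0 then q ^ (2*n-t-1) + q ^ (n - t/2) - q ^ (n - t/2 - 1)
         else q ^ (2*n-t-1) - q ^ (n - t/2 - 1)) * q ^ (2*n-t) := by
  intro Ahat Bhat c
  obtain ⟨k, rfl⟩ : ∃ k, t = 2 * k + 2 := by
    obtain ⟨r, hr⟩ := hteven
    exact ⟨r - 1, by omega⟩
  obtain ⟨m, rfl⟩ : ∃ m, n = k + 1 + m := ⟨n - (k + 1), by omega⟩
  have hN : 2 * (k + 1 + m) + 1 - (2 * k + 2) = 2 * m + 1 := by omega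
  have hk : (2 * k + 2) / 2 - 1 = k := by omega
  let e := interleaveEquiv F hN
  have hc : c = α ⟨0, by omega⟩ ^ 2 + ∑ i : Fin k, α ⟨2 * (i : ℕ) + 1, by omega⟩ *
      α ⟨2 * (i : ℕ) + 2, by omega⟩ := by
    simp only [c]
    congr 1
    exact Fintype.sum_equiv (finCongr hk) _ _ fun i => rfl
  have hlow1 : ∀ i : Fin k, 2 * (i : ℕ) + 1 < 2 * k + 2 := fun i => by omega
  have hlow2 : ∀ i : Fin k, 2 * (i : ℕ) + 2 < 2 * k + 2 := fun i => by omega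
  have hzero : 0 < 2 * k + 2 := by omega
  have hmid : 2 * k + 1 < 2 * k + 2 := by omega
  have hmid' : ¬ 2 * k + 2 < 2 * k + 2 := by omega
  have hhigh1 : ∀ i : ℕ, ¬ 2 * (k + 1 + i) + 1 < 2 * k + 2 := fun i => by omega
  have hhigh2 : ∀ i : ℕ, ¬ 2 * (k + 1 + i) + 2 < 2 * k + 2 := fun i => by omega
  have hs1 : ∀ i : ℕ, 2 * (k + 1 + i) + 1 - (2 * k + 2) = 2 * i + 1 := fun i => by omega
  have hs2 : ∀ i : ℕ, 2 * (k + 1 + i) + 2 - (2 * k + 2) = 2 * i + 2 := fun i => by omega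
  have hQ : ∀ (γ : Fin (2 * k + 2) → F) (x : Fin (2 * (k + 1 + m) + 1 - (2 * k + 2)) → F),
      Qform (k + 1 + m) (fun j => if h : (j : ℕ) < 2 * k + 2 then γ ⟨j, h⟩
        else x ⟨(j : ℕ) - (2 * k + 2), by have := j.isLt; omega⟩)
      = γ ⟨0, by omega⟩ ^ 2 + ∑ i : Fin k, γ ⟨2 * (i : ℕ) + 1, by omega⟩ *
          γ ⟨2 * (i : ℕ) + 2, by omega⟩
        + ∑ i, (e x).2.1 i * (e x).2.2 i + γ ⟨2 * k + 1, by omega⟩ * (e x).1 := by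
    intro γ x
    simp only [Qform, Fin.sum_univ_add, Fin.sum_univ_one, Fin.val_castAdd, Fin.val_natAdd,
      Fin.val_zero, add_zero, hlow1, hlow2, hmid, hmid', hhigh1, hhigh2, hs1, hs2, hzero,
      Nat.sub_self, dite_true, dite_false, e, interleaveEquiv, Equiv.coe_fn_mk]
    ring
  have hB : ∀ (x y : Fin (2 * (k + 1 + m) + 1 - (2 * k + 2)) → F),
      bform (k + 1 + m) (Ahat x) (Bhat y)
      = 2 * α ⟨0, by omega⟩ * β ⟨0, by omega⟩ + ∑ i : Fin k,
          (α ⟨2 * (i : ℕ) + 1, by omega⟩ * β ⟨2 * (i : ℕ) + 2, by omega⟩ +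
            α ⟨2 * (i : ℕ) + 2, by omega⟩ * β ⟨2 * (i : ℕ) + 1, by omega⟩)
        + ∑ i, ((e x).2.1 i * (e y).2.2 i + (e x).2.2 i * (e y).2.1 i)
        + α ⟨2 * k + 1, by omega⟩ * (e y).1 + β ⟨2 * k + 1, by omega⟩ * (e x).1 := by
    intro x y
    simp only [bform, Ahat, Bhat, Fin.sum_univ_add, Fin.sum_univ_one, Fin.val_castAdd,
      Fin.val_natAdd, Fin.val_zero, add_zero, hlow1, hlow2, hmid, hmid', hhigh1, hhigh2, hs1, hs2,
      hzero, Nat.sub_self, dite_true, dite_false, e, interleaveEquiv, Equiv.coe_fn_mk]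
    ring
  have hα0 : α ⟨2 * k + 1, by omega⟩ = 0 := hαt
  have hβ0 : β ⟨2 * k + 1, by omega⟩ ≠ 0 := hβt
  have hcard := card_pairs_of_linear_conditions
    (fun p : (Fin m → F) × (Fin m → F) => c + ∑ i, p.1 i * p.2 i = 0)
    (fun p => β ⟨0, by omega⟩ ^ 2 + ∑ i : Fin k, β ⟨2 * (i : ℕ) + 1, by omega⟩ *
      β ⟨2 * (i : ℕ) + 2, by omega⟩ + ∑ i, p.1 i * p.2 i)
    (fun p r => 2 * α ⟨0, by omega⟩ * β ⟨0, by omega⟩ + ∑ i : Fin k,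
          (α ⟨2 * (i : ℕ) + 1, by omega⟩ * β ⟨2 * (i : ℕ) + 2, by omega⟩ +
            α ⟨2 * (i : ℕ) + 2, by omega⟩ * β ⟨2 * (i : ℕ) + 1, by omega⟩)
        + ∑ i, (p.1 i * r.2 i + p.2 i * r.1 i)) hβ0
  refine Eq.trans ?_ (hcard.trans ?_)
  · refine Nat.card_congr (Equiv.subtypeEquiv (e.prodCongr e) fun p => ?_)
    rw [hB, hQ, hQ, hα0, ← hc, zero_mul, zero_mul, add_zero, add_zero]
    exact Iff.rfl
  rw [natCard_hyperbolic, hq]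
  have i1 : 2 * (k + 1 + m) - (2 * k + 2) = 2 * m := by omega
  have i2 : k + 1 + m - (2 * k + 2) / 2 = m := by omega
  rw [i1, i2]
  congr 1
  simp [hq, two_mul, pow_add]
end

section
/- Let q be a prime power, F_q the finite field with q elements, n ≥ 2, and let t be odd with 3 ≤ t ≤ 2n − 1. Let S be a 2 × t matrix over F_q in RREF whose last column (α_t, β_t)ᵀ is not the zero column. Then the number of 2 × (2n) matrices G over F_q in RREF such that the first t columns of G form the matrix S and the two rows of G span a totally isotropic 2-dimensional subspace of F_q^{2n} for the form s equals q^{4n−2t−1}. -/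
/-- A `2 × L` matrix over a field is in row reduced echelon form: both rows are
nonzero, the leading entry of each row is `1`, the pivot of the second row lies
strictly to the right of the pivot of the first row, and the entry of the first
row in the pivot column of the second row is `0`. -/
def IsRREF2 {F : Type*} [Field F] {L : ℕ} (M : Matrix (Fin 2) (Fin L) F) : Prop :=
  ∃ j₀ j₁ : Fin L, j₀ < j₁ ∧
    M 0 j₀ = 1 ∧ (∀ j, j < j₀ → M 0 j = 0) ∧
    M 1 j₁ = 1 ∧ (∀ j, j < j₁ → M 1 j = 0) ∧
    M 0 j₁ = 0

/-- The standard symplectic form `s(x,y) = Σ_{i=1}^n (x_{2i-1} y_{2i} - x_{2i} y_{2i-1})`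
on `F^{2n}` (coordinates 0-indexed). -/
def sform {F : Type*} [Field F] (n : ℕ) (x y : Fin (2*n) → F) : F :=
  ∑ i : Fin n,
    (x ⟨2*(i:ℕ), by have := i.isLt; omega⟩ * y ⟨2*(i:ℕ)+1, by have := i.isLt; omega⟩ -
     x ⟨2*(i:ℕ)+1, by have := i.isLt; omega⟩ * y ⟨2*(i:ℕ), by have := i.isLt; omega⟩)

/-- The rows of `G` span a totally isotropic 2-dimensional subspace of `F^{2n}`
for the standard symplectic form. -/
def TotIso {F : Type*} [Field F] (n : ℕ) (G : Matrix (Fin 2) (Fin (2*n)) F) : Prop :=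
  Module.finrank F ↥(Submodule.span F ({G 0, G 1} : Set (Fin (2*n) → F))) = 2 ∧
  ∀ u ∈ Submodule.span F ({G 0, G 1} : Set (Fin (2*n) → F)),
    ∀ v ∈ Submodule.span F ({G 0, G 1} : Set (Fin (2*n) → F)), sform n u v = 0

section Counting

variable {F : Type*}

/-- The `2 × L` matrices whose first `t` columns are prescribed are parametrised by
the `2 × (L - t)` matrices. -/
lemma card_extensions {t L : ℕ} (htL : t ≤ L) (S : Matrix (Fin 2) (Fin t) F) :
    Nat.card {G : Matrix (Fin 2) (Fin L) F // ∀ i (j : Fin t), G i (Fin.castLE htL j) = S i j}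
      = Nat.card F ^ (2 * (L - t)) := by
  have e : {G : Matrix (Fin 2) (Fin L) F // ∀ i (j : Fin t), G i (Fin.castLE htL j) = S i j} ≃
      (Fin 2 → Fin (L - t) → F) :=
    { toFun := fun G i j => G.1 i ⟨t + j, by omega⟩
      invFun := fun v => ⟨fun i j => if h : (j : ℕ) < t then S i ⟨j, h⟩ else
        v i ⟨j - t, by omega⟩, fun i j => by simp⟩
      left_inv := fun G => by
        ext i j
        by_cases h : (j : ℕ) < t
        · simpa [h] using (G.2 i ⟨j, h⟩).symm
        · simp [h, Nat.add_sub_cancel' (not_lt.mp h)]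
      right_inv := fun v => by
        ext i j
        simp }
  rw [Nat.card_congr e]
  simp [Nat.card_fun, ← pow_mul, mul_comm]

variable [Field F]

/-- If `f` increases by `c` under translation by `c • w` and `P` is stable under these
translations, the zeros of `f` in `P` are a fraction `1 / |F|` of `P`. -/
lemma card_eq_card_zeros_mul {V : Type*} [AddCommGroup V] [Module F V]
    (P : V → Prop) (f : V → F) (w : V) (hP : ∀ v (c : F), P v → P (v + c • w))
    (hf : ∀ v c, P v → f (v + c • w) = f v + c) :
    Nat.card {v // P v} = Nat.card {v // P v ∧ f v = 0} * Nat.card F := by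
  rw [← Nat.card_prod]
  refine Nat.card_congr
    { toFun := fun v => (⟨v.1 + (-f v.1) • w, hP _ _ v.2, by rw [hf _ _ v.2]; ring⟩, f v.1)
      invFun := fun z => ⟨z.1.1 + z.2 • w, hP _ _ z.1.2.1⟩
      left_inv := fun v => by ext1; simp
      right_inv := ?_ }
  rintro ⟨⟨v, hv, h0⟩, c⟩
  ext1
  · ext1
    simp [hf v c hv, h0]
  · simp [hf v c hv, h0]

lemma sform_add_single {n : ℕ} (m : Fin n) (x y : Fin (2*n) → F) (a b : F) :
    sform n (x + Pi.single ⟨2*(m:ℕ)+1, by omega⟩ a) (y + Pi.single ⟨2*(m:ℕ)+1, by omega⟩ b)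
      = sform n x y + (x ⟨2*(m:ℕ), by omega⟩ * b - a * y ⟨2*(m:ℕ), by omega⟩) := by
  have key : ∀ i : Fin n, ∀ c : F,
      (Pi.single ⟨2*(m:ℕ)+1, by omega⟩ c : Fin (2*n) → F) ⟨2*(i:ℕ)+1, by omega⟩
        = if i = m then c else 0 := by
    intro i c
    simp [Pi.single_apply, Fin.ext_iff]
  have key' : ∀ i : Fin n, ∀ c : F,
      (Pi.single ⟨2*(m:ℕ)+1, by omega⟩ c : Fin (2*n) → F) ⟨2*(i:ℕ), by omega⟩ = 0 := by
    intro i c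
    rw [Pi.single_apply, if_neg]
    simp only [Fin.ext_iff]
    omega
  have hsum : x ⟨2*(m:ℕ), by omega⟩ * b - a * y ⟨2*(m:ℕ), by omega⟩ =
      ∑ i : Fin n, if i = m then
        x ⟨2*(i:ℕ), by omega⟩ * b - a * y ⟨2*(i:ℕ), by omega⟩ else 0 := by
    simp
  rw [hsum]
  unfold sform
  rw [← Finset.sum_add_distrib]
  refine Finset.sum_congr rfl fun i _ => ?_
  simp only [Pi.add_apply, key, key']
  split_ifs <;> ring

lemma sform_smul_add (n : ℕ) (x y : Fin (2*n) → F) (a b c d : F) :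
    sform n (a • x + b • y) (c • x + d • y) = (a * d - b * c) * sform n x y := by
  unfold sform
  rw [Finset.mul_sum]
  refine Finset.sum_congr rfl fun i _ => ?_
  simp only [Pi.add_apply, Pi.smul_apply, smul_eq_mul]
  ring

lemma IsRREF2.finrank_span {L : ℕ} {G : Matrix (Fin 2) (Fin L) F} (hG : IsRREF2 G) :
    Module.finrank F ↥(Submodule.span F ({G 0, G 1} : Set (Fin L → F))) = 2 := by
  obtain ⟨j₀, j₁, hlt, h0, -, h1, h1z, h01⟩ := hG
  have hli : LinearIndependent F G := by
    refine Fintype.linearIndependent_iff.mpr fun g hg => ?_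
    have hc := fun j => congrFun hg j
    simp only [Fin.sum_univ_two, Pi.add_apply, Pi.smul_apply, smul_eq_mul, Pi.zero_apply] at hc
    have g1 : g 1 = 0 := by simpa [h1, h01] using hc j₁
    have g0 : g 0 = 0 := by simpa [h0, g1] using hc j₀
    exact Fin.forall_fin_two.mpr ⟨g0, g1⟩
  have hrange : ({G 0, G 1} : Set (Fin L → F)) = Set.range G := by
    ext v
    refine ⟨?_, ?_⟩
    · rintro (rfl | rfl)
      exacts [⟨0, rfl⟩, ⟨1, rfl⟩]
    · rintro ⟨i, rfl⟩
      fin_cases i <;> simp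
  rw [hrange, finrank_span_eq_card hli, Fintype.card_fin]

lemma IsRREF2.totIso_iff {n : ℕ} {G : Matrix (Fin 2) (Fin (2*n)) F} (hG : IsRREF2 G) :
    TotIso n G ↔ sform n (G 0) (G 1) = 0 := by
  refine ⟨fun h => h.2 _ (Submodule.subset_span (by simp)) _ (Submodule.subset_span (by simp)),
    fun h => ⟨hG.finrank_span, fun u hu v hv => ?_⟩⟩
  obtain ⟨a, b, rfl⟩ := Submodule.mem_span_pair.mp hu
  obtain ⟨c, d, rfl⟩ := Submodule.mem_span_pair.mp hv
  rw [sform_smul_add, h, mul_zero]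

lemma IsRREF2.of_castLE {t L : ℕ} (htL : t ≤ L) {S : Matrix (Fin 2) (Fin t) F} (hS : IsRREF2 S)
    {G : Matrix (Fin 2) (Fin L) F} (hG : ∀ i (j : Fin t), G i (Fin.castLE htL j) = S i j) :
    IsRREF2 G := by
  obtain ⟨j₀, j₁, hlt, h0, h0z, h1, h1z, h01⟩ := hS
  refine ⟨Fin.castLE htL j₀, Fin.castLE htL j₁, hlt, by rw [hG, h0], fun j hj => ?_,
    by rw [hG, h1], fun j hj => ?_, by rw [hG, h01]⟩
  · exact (hG 0 ⟨j, lt_trans hj j₀.2⟩).trans (h0z _ hj)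
  · exact (hG 1 ⟨j, lt_trans hj j₁.2⟩).trans (h1z _ hj)

lemma exists_mul_sub_mul_eq_one {x y : F} (h : ¬ (x = 0 ∧ y = 0)) :
    ∃ a b : F, x * b - a * y = 1 := by
  by_cases hx : x = 0
  · have hy : y ≠ 0 := fun hy => h ⟨hx, hy⟩
    exact ⟨-y⁻¹, 0, by simp [hy]⟩
  · exact ⟨0, x⁻¹, by simp [hx]⟩

end Counting

theorem stmt9 (q n t : ℕ) (hn : 2 ≤ n) (ht3 : 3 ≤ t) (htn : t ≤ 2*n - 1) (htodd : Odd t)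
    (F : Type*) [Field F] [Fintype F] (hq : Fintype.card F = q)
    (S : Matrix (Fin 2) (Fin t) F) (hS : IsRREF2 S)
    (hlast : ¬ (S 0 ⟨t-1, by omega⟩ = 0 ∧ S 1 ⟨t-1, by omega⟩ = 0)) :
    Nat.card {G : Matrix (Fin 2) (Fin (2*n)) F //
        IsRREF2 G ∧
        (∀ (i : Fin 2) (j : Fin t), G i (Fin.castLE (by omega) j) = S i j) ∧
        TotIso n G}
      = q ^ (4*n - 2*t - 1) := by
  have htL : t ≤ 2*n := by omega
  obtain ⟨m, rfl⟩ := htodd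
  obtain ⟨a, b, hab⟩ := exists_mul_sub_mul_eq_one hlast
  let k : Fin (2*n) := ⟨2*m+1, by omega⟩
  let P : Matrix (Fin 2) (Fin (2*n)) F → Prop :=
    fun G => ∀ i (j : Fin (2*m+1)), G i (Fin.castLE htL j) = S i j
  have hfin : Nat.card {G : Matrix (Fin 2) (Fin (2*n)) F // IsRREF2 G ∧ P G ∧ TotIso n G} =
      Nat.card {G : Matrix (Fin 2) (Fin (2*n)) F // P G ∧ sform n (G 0) (G 1) = 0} := by
    refine Nat.card_congr (Equiv.subtypeEquivRight fun G => ⟨fun h => ?_, fun h => ?_⟩)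
    · exact ⟨h.2.1, h.1.totIso_iff.mp h.2.2⟩
    · have hG := hS.of_castLE htL h.1
      exact ⟨hG, h.1, hG.totIso_iff.mpr h.2⟩
  have hcount := card_eq_card_zeros_mul P (fun G => sform n (G 0) (G 1))
    (Matrix.of ![Pi.single k a, Pi.single k b])
    (fun G c hG i j => by
      have hk : Fin.castLE htL j ≠ k := by
        simp only [ne_eq, Fin.ext_iff, Fin.val_castLE, k]
        omega
      rw [← hG i j]
      fin_cases i <;> simp [hk])
    (fun G c hG => by
      have h0 := hG 0 ⟨2*m, by omega⟩
      have h1 := hG 1 ⟨2*m, by omega⟩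
      have hadd := sform_add_single ⟨m, by omega⟩ (G 0) (G 1) (c * a) (c * b)
      simp only [Fin.castLE_mk] at h0 h1
      simp only [Nat.add_sub_cancel] at hab
      have e0 : (G + c • Matrix.of ![Pi.single k a, Pi.single k b]) 0 =
          G 0 + Pi.single k (c * a) := by
        ext j; simp [Pi.single_apply]
      have e1 : (G + c • Matrix.of ![Pi.single k a, Pi.single k b]) 1 =
          G 1 + Pi.single k (c * b) := by
        ext j; simp [Pi.single_apply]
      simp only [e0, e1]
      refine hadd.trans ?_
      rw [h0, h1]
      linear_combination c * hab)
  rw [card_extensions htL S, ← hfin, Nat.card_eq_fintype_card (α := F), hq] at hcount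
  have hq0 : 0 < q := hq ▸ Fintype.card_pos
  refine Nat.eq_of_mul_eq_mul_right hq0 (hcount.symm.trans ?_)
  rw [← pow_succ]
  congr 1
  omega
end

section
/- Let q be an odd prime power, F_q the finite field with q elements, and n ≥ 3. Let ζ : F_q^{2n+1} × F_q^{2n+1} → F_q be an alternating bilinear form such that ζ(u, v) = 0 for all u, v ∈ F_q^{2n+1} satisfying Q(u) = 0, Q(v) = 0 and b(u, v) = 0. Then ζ is identically zero. -/
section HyperbolicBasis

variable {F : Type*} [Field F] {n : ℕ}

/-- The anisotropic basis vector of `F^{2n+1}`. -/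
def anisoVec (F : Type*) [Field F] (n : ℕ) : Fin (2*n+1) → F :=
  Pi.single ⟨0, by omega⟩ 1

/-- The first vector of the `i`-th hyperbolic pair. -/
def hypLeft (F : Type*) [Field F] {n : ℕ} (i : Fin n) : Fin (2*n+1) → F :=
  Pi.single ⟨2*(i:ℕ)+1, by have := i.isLt; omega⟩ 1

/-- The second vector of the `i`-th hyperbolic pair. -/
def hypRight (F : Type*) [Field F] {n : ℕ} (i : Fin n) : Fin (2*n+1) → F :=
  Pi.single ⟨2*(i:ℕ)+2, by have := i.isLt; omega⟩ 1

lemma bform_add_left (x y z : Fin (2*n+1) → F) :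
    bform n (x + y) z = bform n x z + bform n y z := by
  have h (a b c d : F) (f g : Fin n → F) : a + b = c → d = ∑ i, (f i + g i) →
      c + d = a + ∑ i, f i + (b + ∑ i, g i) := by
    rintro rfl rfl
    rw [Finset.sum_add_distrib]
    ring
  refine h _ _ _ _ _ _ ?_ (Finset.sum_congr rfl fun i _ => ?_) <;>
    simp only [Pi.add_apply] <;> ring

lemma bform_comm (x y : Fin (2*n+1) → F) : bform n x y = bform n y x := by
  unfold bform
  congr 1
  · ring
  · exact Finset.sum_congr rfl fun i _ => by ring

lemma bform_neg_left (x y : Fin (2*n+1) → F) : bform n (-x) y = -bform n x y := by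
  unfold bform
  rw [neg_add, ← Finset.sum_neg_distrib]
  congr 1
  · simp
  · exact Finset.sum_congr rfl fun i _ => by simp only [Pi.neg_apply]; ring

lemma bform_add_right (x y z : Fin (2*n+1) → F) :
    bform n x (y + z) = bform n x y + bform n x z := by
  simp only [bform_comm x, bform_add_left]

lemma bform_neg_right (x y : Fin (2*n+1) → F) : bform n x (-y) = -bform n x y := by
  simp only [bform_comm x, bform_neg_left]

lemma Qform_add (x y : Fin (2*n+1) → F) :
    Qform n (x + y) = Qform n x + Qform n y + bform n x y := by
  have h (a b c d e : F) (f g k : Fin n → F) : d = a + b + c → e = ∑ i, (f i + g i + k i) →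
      d + e = a + ∑ i, f i + (b + ∑ i, g i) + (c + ∑ i, k i) := by
    rintro rfl rfl
    rw [Finset.sum_add_distrib, Finset.sum_add_distrib]
    ring
  refine h _ _ _ _ _ _ _ _ ?_ (Finset.sum_congr rfl fun i _ => ?_) <;>
    simp only [Pi.add_apply] <;> ring

lemma Qform_neg (x : Fin (2*n+1) → F) : Qform n (-x) = Qform n x := by
  simp [Qform]

lemma Qform_anisoVec : Qform n (anisoVec F n) = 1 := by
  simp [Qform, anisoVec]

lemma Qform_hypLeft (i : Fin n) : Qform n (hypLeft F i) = 0 := by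
  simp [Qform, hypLeft, Pi.single_apply, Nat.two_mul_ne_two_mul_add_one.symm]

lemma Qform_hypRight (i : Fin n) : Qform n (hypRight F i) = 0 := by
  simp [Qform, hypRight, Pi.single_apply, Nat.two_mul_ne_two_mul_add_one]

lemma bform_anisoVec_hypLeft (i : Fin n) : bform n (anisoVec F n) (hypLeft F i) = 0 := by
  simp [bform, anisoVec, hypLeft, Pi.single_apply]

lemma bform_anisoVec_hypRight (i : Fin n) : bform n (anisoVec F n) (hypRight F i) = 0 := by
  simp [bform, anisoVec, hypRight, Pi.single_apply]

lemma bform_hypLeft_hypLeft (i j : Fin n) : bform n (hypLeft F i) (hypLeft F j) = 0 := by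
  simp [bform, hypLeft, Pi.single_apply, Nat.two_mul_ne_two_mul_add_one.symm]

lemma bform_hypRight_hypRight (i j : Fin n) : bform n (hypRight F i) (hypRight F j) = 0 := by
  simp [bform, hypRight, Pi.single_apply, Nat.two_mul_ne_two_mul_add_one]

lemma bform_hypLeft_hypRight (i j : Fin n) :
    bform n (hypLeft F i) (hypRight F j) = if i = j then 1 else 0 := by
  simp [bform, hypLeft, hypRight, Pi.single_apply, Nat.two_mul_ne_two_mul_add_one,
    Fin.val_inj, @eq_comm _ j]

lemma bform_hypRight_hypLeft (i j : Fin n) :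
    bform n (hypRight F i) (hypLeft F j) = if j = i then 1 else 0 := by
  rw [bform_comm, bform_hypLeft_hypRight]

lemma hyperbolicBasis_cases {p : (Fin (2*n+1) → F) → Prop} (h₀ : p (anisoVec F n))
    (hl : ∀ i, p (hypLeft F i)) (hr : ∀ i, p (hypRight F i)) (k : Fin (2*n+1)) :
    p (Pi.single k 1) := by
  obtain ⟨k, hk⟩ := k
  obtain rfl | ⟨m, rfl | rfl⟩ : k = 0 ∨ ∃ m, k = 2*m+1 ∨ k = 2*m+2 := by
    rcases Nat.eq_zero_or_pos k with h | h
    · exact Or.inl h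
    · exact Or.inr ⟨(k-1)/2, by omega⟩
  · exact h₀
  · exact hl ⟨m, by omega⟩
  · exact hr ⟨m, by omega⟩

/-- An alternating bilinear form vanishing on pairs of hyperbolic basis vectors is zero. -/
lemma eq_zero_of_hyperbolicBasis {ζ : (Fin (2*n+1) → F) →ₗ[F] (Fin (2*n+1) → F) →ₗ[F] F}
    (halt : ∀ v, ζ v v = 0) (h₀l : ∀ i, ζ (anisoVec F n) (hypLeft F i) = 0)
    (h₀r : ∀ i, ζ (anisoVec F n) (hypRight F i) = 0)
    (hll : ∀ i j, ζ (hypLeft F i) (hypLeft F j) = 0)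
    (hlr : ∀ i j, ζ (hypLeft F i) (hypRight F j) = 0)
    (hrr : ∀ i j, ζ (hypRight F i) (hypRight F j) = 0) : ζ = 0 := by
  have hsymm {u v} (h : ζ u v = 0) : ζ v u = 0 := by
    rw [← LinearMap.IsAlt.neg halt, h, neg_zero]
  refine (Pi.basisFun F _).ext fun k => (Pi.basisFun F _).ext fun l => ?_
  simp only [Pi.basisFun_apply, LinearMap.zero_apply]
  refine hyperbolicBasis_cases (p := fun v => ζ v (Pi.single l 1) = 0) ?_ (fun i => ?_)
    (fun i => ?_) k
  · exact hyperbolicBasis_cases (p := fun v => ζ _ v = 0) (halt _) h₀l h₀r l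
  · exact hyperbolicBasis_cases (p := fun v => ζ _ v = 0) (hsymm (h₀l i)) (hll i) (hlr i) l
  · exact hyperbolicBasis_cases (p := fun v => ζ _ v = 0) (hsymm (h₀r i))
      (fun j => hsymm (hlr j i)) (hrr i) l

end HyperbolicBasis

theorem stmt13 (q n : ℕ) (hn : 3 ≤ n) (F : Type*) [Field F] [Fintype F]
    (hq : Fintype.card F = q) (hodd : Odd q)
    (ζ : (Fin (2*n+1) → F) →ₗ[F] (Fin (2*n+1) → F) →ₗ[F] F)
    (halt : ∀ v, ζ v v = 0)
    (hvan : ∀ u v, Qform n u = 0 → Qform n v = 0 → bform n u v = 0 → ζ u v = 0) :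
    ζ = 0 := by
  have h2 : (2 : F) ≠ 0 := by
    refine Ring.two_ne_zero fun h => ?_
    have := FiniteField.even_card_of_char_two h
    rw [hq] at this
    exact absurd (Nat.odd_iff.mp hodd) (by omega)
  have : Nontrivial (Fin n) := Fin.nontrivial_iff_two_le.mpr (by omega)
  have hll (i j : Fin n) : ζ (hypLeft F i) (hypLeft F j) = 0 :=
    hvan _ _ (Qform_hypLeft i) (Qform_hypLeft j) (bform_hypLeft_hypLeft i j)
  have hrr (i j : Fin n) : ζ (hypRight F i) (hypRight F j) = 0 :=
    hvan _ _ (Qform_hypRight i) (Qform_hypRight j) (bform_hypRight_hypRight i j)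
  have hlr {i j : Fin n} (hij : i ≠ j) : ζ (hypLeft F i) (hypRight F j) = 0 :=
    hvan _ _ (Qform_hypLeft i) (Qform_hypRight j) (by simp [bform_hypLeft_hypRight, hij])
  have hrl {i j : Fin n} (hij : i ≠ j) : ζ (hypRight F i) (hypLeft F j) = 0 :=
    hvan _ _ (Qform_hypRight i) (Qform_hypLeft j) (by simp [bform_hypRight_hypLeft, hij.symm])
  have hQ (i : Fin n) : Qform n (anisoVec F n + hypLeft F i + -hypRight F i) = 0 := by
    simp [Qform_add, Qform_neg, Qform_anisoVec, Qform_hypLeft, Qform_hypRight, bform_add_left,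
      bform_neg_right, bform_anisoVec_hypLeft, bform_anisoVec_hypRight, bform_hypLeft_hypRight]
  refine eq_zero_of_hyperbolicBasis halt (fun j => ?_) (fun j => ?_) hll (fun i j => ?_) hrr
  · obtain ⟨i, hij⟩ := exists_ne j
    have h := hvan _ _ (hQ i) (Qform_hypLeft j) (by
      simp [bform_add_left, bform_neg_left, bform_anisoVec_hypLeft, bform_hypLeft_hypLeft,
        bform_hypRight_hypLeft, hij.symm])
    simpa [hll, hrl hij] using h
  · obtain ⟨i, hij⟩ := exists_ne j
    have h := hvan _ _ (hQ i) (Qform_hypRight j) (by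
      simp [bform_add_left, bform_neg_left, bform_anisoVec_hypRight, bform_hypRight_hypRight,
        bform_hypLeft_hypRight, hij])
    simpa [hrr, hlr hij] using h
  · rcases ne_or_eq i j with hij | rfl
    · exact hlr hij
    obtain ⟨j, hji⟩ := exists_ne i
    have hdiff := hvan (hypLeft F i + hypLeft F j) (hypRight F i + -hypRight F j)
      (by simp [Qform_add, Qform_hypLeft, bform_hypLeft_hypLeft])
      (by simp [Qform_add, Qform_neg, Qform_hypRight, bform_neg_right, bform_hypRight_hypRight])
      (by simp [bform_add_left, bform_add_right, bform_neg_right, bform_hypLeft_hypRight, hji,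
        hji.symm])
    have hsum := hvan (hypLeft F i + -hypRight F j) (hypRight F i + hypLeft F j)
      (by simp [Qform_add, Qform_neg, Qform_hypLeft, Qform_hypRight, bform_neg_right,
        bform_hypLeft_hypRight, hji.symm])
      (by simp [Qform_add, Qform_hypLeft, Qform_hypRight, bform_hypRight_hypLeft, hji])
      (by simp [bform_add_left, bform_add_right, bform_neg_left, bform_hypLeft_hypRight,
        bform_hypRight_hypLeft, bform_hypLeft_hypLeft, bform_hypRight_hypRight])
    have hswap := LinearMap.IsAlt.neg (B := ζ) halt (hypLeft F j) (hypRight F j)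
    simp only [map_add, map_neg, LinearMap.add_apply, LinearMap.neg_apply, hlr hji,
      hlr hji.symm, hll, hrr] at hdiff hsum
    refine (mul_eq_zero.mp ?_).resolve_left h2
    linear_combination hdiff + hsum - hswap
end

section
/- Let q be a prime power, F_q the finite field with q elements, and n ≥ 2. The number of 2-dimensional totally isotropic subspaces of F_q^{2n} for the standard symplectic form s equals (q^{2n} − 1)(q^{2n−2} − 1) / ((q − 1)(q² − 1)). -/
section IsotropicPlanes

open Module

variable {F V : Type*} [Field F] [AddCommGroup V] [Module F V]

/-- The ordered bases of the totally isotropic planes of an alternating bilinear form. -/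
def IsotropicPair (B : V →ₗ[F] V →ₗ[F] F) : Type _ :=
  {f : Fin 2 → V // LinearIndependent F f ∧ B (f 1) (f 0) = 0}

/-- The totally isotropic planes of a bilinear form. -/
def IsotropicPlane (B : V →ₗ[F] V →ₗ[F] F) : Type _ :=
  {W : Submodule F V // finrank F W = 2 ∧ ∀ u ∈ W, ∀ v ∈ W, B u v = 0}

/-- An alternating form vanishes on the span of two orthogonal vectors. -/
lemma eq_zero_of_mem_span_pair {B : V →ₗ[F] V →ₗ[F] F} (hB : B.IsAlt) {x y : V}
    (hxy : B y x = 0) {u v : V} (hu : u ∈ Submodule.span F {x, y})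
    (hv : v ∈ Submodule.span F {x, y}) : B u v = 0 := by
  obtain ⟨a, b, rfl⟩ := Submodule.mem_span_pair.1 hu
  obtain ⟨c, d, rfl⟩ := Submodule.mem_span_pair.1 hv
  have hyx : B x y = 0 := by rw [← hB.neg, hxy, neg_zero]
  simp [hxy, hyx, hB.self_eq_zero]

lemma range_fin_two_eq_pair {α : Type*} (f : Fin 2 → α) : Set.range f = {f 0, f 1} := by
  ext; simp [Fin.exists_fin_two, eq_comm]

/-- An isotropic pair is the same as an isotropic plane together with a basis of it. -/
noncomputable def isotropicPairEquiv {B : V →ₗ[F] V →ₗ[F] F} (hB : B.IsAlt) :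
    IsotropicPair B ≃
      Σ W : IsotropicPlane B, {w : Fin 2 → W.1 // LinearIndependent F w} where
  toFun f := ⟨⟨Submodule.span F (Set.range f.1), by
      simpa using finrank_span_eq_card f.2.1, fun u hu v hv => by
      rw [range_fin_two_eq_pair] at hu hv
      exact eq_zero_of_mem_span_pair hB f.2.2 hu hv⟩,
    ⟨fun i => ⟨f.1 i, Submodule.subset_span ⟨i, rfl⟩⟩, linearIndependent_span f.2.1⟩⟩
  invFun p := ⟨fun i => (p.2.1 i : V),
    p.2.2.map' p.1.1.subtype (Submodule.ker_subtype _), p.1.2.2 _ (p.2.1 1).2 _ (p.2.1 0).2⟩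
  left_inv f := rfl
  right_inv := by
    rintro ⟨⟨W, hW, hiso⟩, ⟨w, hw⟩⟩
    have hspan : Submodule.span F (Set.range fun i => (w i : V)) = W := by
      have : FiniteDimensional F W := FiniteDimensional.of_finrank_pos (by omega)
      refine Submodule.eq_of_le_of_finrank_eq
        (Submodule.span_le.2 (by rintro _ ⟨i, rfl⟩; exact (w i).2)) ?_
      exact (finrank_span_eq_card (hw.map' W.subtype (Submodule.ker_subtype _))).trans
        (by rw [hW, Fintype.card_fin])
    have key : ∀ (W' : Submodule F V) (h : W' = W) (h' : _) (w' : Fin 2 → W')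
        (hw' : LinearIndependent F w'), (∀ i, (w' i : V) = w i) →
        (⟨⟨W', h'⟩, ⟨w', hw'⟩⟩ :
          Σ W : IsotropicPlane B, {w : Fin 2 → W.1 // LinearIndependent F w}) =
          ⟨⟨W, hW, hiso⟩, ⟨w, hw⟩⟩ := by
      rintro W' rfl h' w' hw' hi
      obtain rfl : w' = w := funext fun i => Subtype.ext (hi i)
      rfl
    exact key _ hspan _ _ _ fun i => rfl

/-- An isotropic pair is a nonzero vector followed by a vector orthogonal to it and outside
the line it spans. -/
def isotropicPairEquivSigma (B : V →ₗ[F] V →ₗ[F] F) :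
    IsotropicPair B ≃ Σ u : {u : V // u ≠ 0},
      ((LinearMap.ker (B u.1) : Set V) \ (Submodule.span F {u.1} : Set V) : Set V) where
  toFun f := ⟨⟨f.1 1, (linearIndependent_fin2.1 f.2.1).1⟩, f.1 0, f.2.2, fun h => by
    obtain ⟨a, ha⟩ := Submodule.mem_span_singleton.1 h
    exact (linearIndependent_fin2.1 f.2.1).2 a ha⟩
  invFun p := ⟨![p.2.1, p.1.1], linearIndependent_fin2.2 ⟨p.1.2, fun a ha =>
    p.2.2.2 (Submodule.mem_span_singleton.2 ⟨a, ha⟩)⟩, p.2.2.1⟩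
  left_inv f := Subtype.ext (by funext i; fin_cases i <;> rfl)
  right_inv p := rfl

variable [Fintype F] [FiniteDimensional F V]

lemma card_ker_sdiff_span {B : V →ₗ[F] V →ₗ[F] F} (hB : B.IsAlt) (hnd : B.SeparatingLeft)
    {u : V} (hu : u ≠ 0) :
    Nat.card ((LinearMap.ker (B u) : Set V) \ (Submodule.span F {u} : Set V) : Set V) =
      Fintype.card F ^ (finrank F V - 1) - Fintype.card F := by
  have : Finite V := Module.finite_of_finite F
  have hBu : B u ≠ 0 := fun h => hu (hnd u fun y => by simp [h])
  have hker : finrank F (LinearMap.ker (B u)) = finrank F V - 1 := by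
    have := Module.Dual.finrank_ker_add_one_of_ne_zero hBu
    omega
  have hle : (Submodule.span F {u} : Set V) ⊆ LinearMap.ker (B u) := by
    have : Submodule.span F {u} ≤ LinearMap.ker (B u) := by
      simp [Submodule.span_singleton_le_iff_mem, hB.self_eq_zero]
    exact this
  rw [Nat.card_coe_set_eq, Set.ncard_sdiff hle, ← Nat.card_coe_set_eq, ← Nat.card_coe_set_eq]
  congr 1
  · rw [← hker, ← Nat.card_eq_fintype_card]
    exact Module.natCard_eq_pow_finrank
  · rw [← Nat.card_eq_fintype_card]
    exact (Module.natCard_eq_pow_finrank (K := F) (V := Submodule.span F {u})).trans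
      (by rw [finrank_span_singleton hu, pow_one])

lemma card_isotropicPair {B : V →ₗ[F] V →ₗ[F] F} (hB : B.IsAlt) (hnd : B.SeparatingLeft) :
    Nat.card (IsotropicPair B) = (Fintype.card F ^ finrank F V - 1) *
      (Fintype.card F ^ (finrank F V - 1) - Fintype.card F) := by
  classical
  have : Finite V := Module.finite_of_finite F
  have := Fintype.ofFinite V
  rw [Nat.card_congr (isotropicPairEquivSigma B), Nat.card_sigma,
    Finset.sum_congr rfl fun u _ => card_ker_sdiff_span hB hnd u.2]
  simp [Fintype.card_subtype_compl, Module.card_eq_pow_finrank (K := F) (V := V)]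

lemma card_isotropicPlane_mul {B : V →ₗ[F] V →ₗ[F] F} (hB : B.IsAlt) :
    Nat.card (IsotropicPlane B) * ((Fintype.card F ^ 2 - 1) *
      (Fintype.card F ^ 2 - Fintype.card F)) = Nat.card (IsotropicPair B) := by
  classical
  have : Finite V := Module.finite_of_finite F
  have : Finite (IsotropicPlane B) := Subtype.finite
  have := Fintype.ofFinite (IsotropicPlane B)
  rw [Nat.card_congr (isotropicPairEquiv hB), Nat.card_sigma]
  have h (W : IsotropicPlane B) : Nat.card {w : Fin 2 → W.1 // LinearIndependent F w} =
      (Fintype.card F ^ 2 - 1) * (Fintype.card F ^ 2 - Fintype.card F) := by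
    have := card_linearIndependent (K := F) (V := W.1) (k := 2) W.2.1.ge
    simpa [W.2.1, Fin.prod_univ_two] using this
  rw [Finset.sum_congr rfl fun W _ => h W]
  simp

end IsotropicPlanes

section StandardForm

variable {F : Type*} [Field F] (n : ℕ)

/-- `sform` as a bilinear map. -/
def sformBilin : (Fin (2*n) → F) →ₗ[F] (Fin (2*n) → F) →ₗ[F] F :=
  LinearMap.mk₂ F (sform n)
    (fun x y z => by
      simp only [sform, Pi.add_apply, ← Finset.sum_add_distrib]
      exact Finset.sum_congr rfl fun i _ => by ring)
    (fun c x y => by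
      simp only [sform, Pi.smul_apply, smul_eq_mul, Finset.mul_sum]
      exact Finset.sum_congr rfl fun i _ => by ring)
    (fun x y z => by
      simp only [sform, Pi.add_apply, ← Finset.sum_add_distrib]
      exact Finset.sum_congr rfl fun i _ => by ring)
    (fun c x y => by
      simp only [sform, Pi.smul_apply, smul_eq_mul, Finset.mul_sum]
      exact Finset.sum_congr rfl fun i _ => by ring)

lemma sformBilin_isAlt : (sformBilin (F := F) n).IsAlt := fun x => by
  simp only [sformBilin, LinearMap.mk₂_apply, sform]
  exact Finset.sum_eq_zero fun i _ => by ring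

lemma sformBilin_separatingLeft : (sformBilin (F := F) n).SeparatingLeft := by
  intro x hx
  funext ⟨j, hj⟩
  simp only [sformBilin, LinearMap.mk₂_apply, sform] at hx
  rcases Nat.even_or_odd' j with ⟨k, rfl | rfl⟩
  · have h := hx (Pi.single ⟨2*k+1, by omega⟩ 1)
    rw [Finset.sum_eq_single ⟨k, by omega⟩] at h
    · simpa using h
    · intro i _ hi
      have h1 : (i : ℕ) ≠ k := fun h => hi (Fin.ext h)
      have h2 : 2 * (i : ℕ) ≠ 2 * k + 1 := by omega
      simp [h1, h2]
    · simp
  · have h := hx (Pi.single ⟨2*k, by omega⟩ 1)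
    rw [Finset.sum_eq_single ⟨k, by omega⟩] at h
    · simpa using h
    · intro i _ hi
      have h1 : (i : ℕ) ≠ k := fun h => hi (Fin.ext h)
      have h2 : 2 * (i : ℕ) + 1 ≠ 2 * k := by omega
      simp [h1, h2]
    · simp

end StandardForm

theorem stmt18 (q n : ℕ) (hn : 2 ≤ n) (F : Type*) [Field F] [Fintype F]
    (hq : Fintype.card F = q) :
    Nat.card {W : Submodule F (Fin (2*n) → F) //
        Module.finrank F ↥W = 2 ∧ ∀ u ∈ W, ∀ v ∈ W, sform n u v = 0}
      = (q ^ (2*n) - 1) * (q ^ (2*n-2) - 1) / ((q - 1) * (q ^ 2 - 1)) := by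
  have hq1 : 1 < q := hq ▸ Fintype.one_lt_card
  have hcount := (card_isotropicPlane_mul (sformBilin_isAlt (F := F) n)).trans
    (card_isotropicPair (sformBilin_isAlt n) (sformBilin_separatingLeft n))
  rw [hq, Module.finrank_fin_fun] at hcount
  change Nat.card (IsotropicPlane (sformBilin (F := F) n)) = _
  have hsq : 1 < q ^ 2 := Nat.one_lt_pow two_ne_zero hq1
  have hpos : 0 < (q - 1) * (q ^ 2 - 1) := Nat.mul_pos (by omega) (by omega)
  have h1 : q ^ 2 - q = q * (q - 1) := by rw [Nat.mul_sub, mul_one, sq]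
  have h2 : q ^ (2*n-1) - q = q * (q ^ (2*n-2) - 1) := by
    rw [Nat.mul_sub, mul_one, ← pow_succ', show 2*n-2+1 = 2*n-1 by omega]
  rw [h1, h2] at hcount
  refine (Nat.div_eq_of_eq_mul_left hpos ?_).symm
  refine Nat.eq_of_mul_eq_mul_left (show 0 < q by omega) ?_
  linear_combination -hcount
end
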